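/- Let k be a field of characteristic 0 and let ρ, ρ' : G → GL_n(k) be two representations of a group (or monoid) G. If tr(ρ(g^m)) = tr(ρ'(g^m)) for all g ∈ G and all m ≥ 1, then for every g ∈ G the characteristic polynomials of ρ(g) and ρ'(g) coincide. -/

import Mathlib

open Polynomial in
/-- A multiset in a field of characteristic zero is determined by its power sums. -/
theorem Multiset.eq_of_sum_map_pow_eq {K : Type*} [Field K] [CharZero K] {s t : Multiset K}
    (h : ∀ m : ℕ, (s.map (· ^ m)).sum = (t.map (· ^ m)).sum) : s = t := by
  classical
  have sum_eval (p : K[X]) : (s.map p.eval).sum = (t.map p.eval).sum := by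
    induction p using Polynomial.induction_on' with
    | add p q hp hq => simp only [eval_add, Multiset.sum_map_add, hp, hq]
    | monomial m a => simp only [eval_monomial, Multiset.sum_map_mul_left, h]
  ext x
  let p : K[X] := ∏ y ∈ ((s + t).toFinset.erase x), (X - C y)
  have eval_ne_zero : p.eval x ≠ 0 := by
    rw [eval_prod, Finset.prod_ne_zero_iff]
    intro y hy
    simpa [sub_eq_zero] using (Finset.ne_of_mem_erase hy).symm
  have sum_eq_count (u : Multiset K) (hu : u ≤ s + t) :
      (u.map p.eval).sum = u.count x * p.eval x := by
    rw [Multiset.sum_map_eq_nsmul_single x, nsmul_eq_mul]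
    intro y hyx hy
    rw [eval_prod]
    refine Finset.prod_eq_zero (i := y) ?_ (by simp)
    exact Finset.mem_erase.2 ⟨hyx, Multiset.mem_toFinset.2 (Multiset.mem_of_le hu hy)⟩
  have := sum_eval p
  rw [sum_eq_count s (Multiset.le_add_right _ _), sum_eq_count t (Multiset.le_add_left _ _)] at this
  exact_mod_cast mul_right_cancel₀ eval_ne_zero this

namespace Matrix

open Polynomial

variable {n K : Type*} [Fintype n] [DecidableEq n] [Field K] [IsAlgClosed K]

theorem det_aeval_eq_prod_roots_charpoly (A : Matrix n n K) (p : K[X]) :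
    (aeval A p).det = (A.charpoly.roots.map p.eval).prod := by
  have card_roots : A.charpoly.roots.card = Fintype.card n := by
    rw [← (IsAlgClosed.splits A.charpoly).natDegree_eq_card_roots, charpoly_natDegree_eq_dim]
  have det_sub (μ : K) : (A - algebraMap K _ μ).det =
      (A.charpoly.roots.map fun l => l - μ).prod := by
    rw [← neg_sub, det_neg, algebraMap_eq_diagonal]
    have h := eval_charpoly A μ
    rw [(IsAlgClosed.splits A.charpoly).eq_prod_roots_of_monic A.charpoly_monic,
      eval_multiset_prod, Multiset.map_map] at h
    simp only [scalar_apply, Function.comp_def, eval_sub, eval_X, eval_C] at h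
    have key : (algebraMap K (n → K)) μ = fun _ => μ := rfl
    rw [key, ← h, ← card_roots, ← Multiset.card_map (fun l => μ - l), ← Multiset.prod_map_neg,
      Multiset.map_map]
    simp
  rw [(IsAlgClosed.splits p).eq_prod_roots]
  generalize p.roots = r
  generalize p.leadingCoeff = a
  induction r using Multiset.induction_on with
  | empty => simp [algebraMap_eq_diagonal, card_roots]
  | cons μ r ih =>
    have hp : C a * ((μ ::ₘ r).map fun a => X - C a).prod =
        (X - C μ) * (C a * (r.map fun a => X - C a).prod) := by
      rw [Multiset.map_cons, Multiset.prod_cons]; ring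
    rw [hp, map_mul, det_mul, ih]
    simp only [eval_mul (p := X - C μ), Multiset.prod_map_mul]
    simp [det_sub]

theorem charpoly_pow_eq_prod_roots (A : Matrix n n K) (m : ℕ) :
    (A ^ m).charpoly = (A.charpoly.roots.map fun l => X - C (l ^ m)).prod := by
  refine Polynomial.funext fun y => ?_
  have h := det_aeval_eq_prod_roots_charpoly A (C y - X ^ m)
  rw [eval_charpoly, eval_multiset_prod, Multiset.map_map]
  simpa [Function.comp_def, algebraMap_eq_diagonal, Pi.algebraMap_def] using h

theorem trace_pow_eq_sum_roots_charpoly (A : Matrix n n K) (m : ℕ) :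
    (A ^ m).trace = (A.charpoly.roots.map (· ^ m)).sum := by
  have h := roots_multiset_prod_X_sub_C (A.charpoly.roots.map (· ^ m))
  rw [Multiset.map_map] at h
  rw [trace_eq_sum_roots_charpoly, charpoly_pow_eq_prod_roots]
  exact congrArg Multiset.sum h

/-- In characteristic zero, the characteristic polynomial of a matrix is determined by the traces
of its positive powers. -/
theorem charpoly_eq_of_trace_pow_eq {k : Type*} [Field k] [CharZero k] {A B : Matrix n n k}
    (h : ∀ m : ℕ, 0 < m → (A ^ m).trace = (B ^ m).trace) : A.charpoly = B.charpoly := by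
  let f := algebraMap k (AlgebraicClosure k)
  have : CharZero (AlgebraicClosure k) := charZero_of_injective_algebraMap f.injective
  apply Polynomial.map_injective f f.injective
  rw [← charpoly_map, ← charpoly_map,
    (IsAlgClosed.splits (A.map f).charpoly).eq_prod_roots_of_monic (charpoly_monic _),
    (IsAlgClosed.splits (B.map f).charpoly).eq_prod_roots_of_monic (charpoly_monic _)]
  congr 2
  refine Multiset.eq_of_sum_map_pow_eq fun m => ?_
  rw [← trace_pow_eq_sum_roots_charpoly, ← trace_pow_eq_sum_roots_charpoly]
  obtain rfl | hm := m.eq_zero_or_pos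
  · simp
  · rw [← Matrix.map_pow, ← Matrix.map_pow, ← AddMonoidHom.map_trace, ← AddMonoidHom.map_trace, h m hm]

end Matrix


/-- In characteristic `0`, if two representations
`ρ ρ' : G → GL_n(k)` satisfy `tr ρ(g^m) = tr ρ'(g^m)` for all `g` and all
`m ≥ 1`, then the characteristic polynomials of `ρ g` and `ρ' g` agree. -/
theorem stmt_4 (k : Type*) [Field k] [CharZero k] (G : Type*) [Monoid G] (n : ℕ)
    (ρ ρ' : G →* Matrix.GeneralLinearGroup (Fin n) k)
    (htr : ∀ (g : G) (m : ℕ), 0 < m →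
      Matrix.trace ((ρ (g ^ m) : Matrix (Fin n) (Fin n) k)) =
        Matrix.trace ((ρ' (g ^ m) : Matrix (Fin n) (Fin n) k))) :
    ∀ g : G, Matrix.charpoly (ρ g : Matrix (Fin n) (Fin n) k) =
      Matrix.charpoly (ρ' g : Matrix (Fin n) (Fin n) k) := by
  refine fun g => Matrix.charpoly_eq_of_trace_pow_eq fun m hm => ?_
  simpa using htr g m hm
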